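/- Let t ≥ 1 be an integer and let G be a finite simple 3-regular bipartite graph on exactly 6t+8 vertices having exactly six cycles of length 4, any two distinct 4-cycles of G sharing at most one edge, and having exactly 4t+7 cycles of length 6. Then, writing h = 3t, N(P₅+K₂) = 144h² + 320h + 42 (equivalently, N(P₅+K₂) = 1296t² + 960t + 42). -/

import Mathlib

open SimpleGraph

/-- The number of `k`-matchings of a graph `G`: `k`-element sets of pairwise disjoint
edges of `G`, identified with the matching subgraphs of `G` having exactly `k` edges. -/
noncomputable def numMatchings {V : Type*} (G : SimpleGraph V) (k : ℕ) : ℕ :=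
  Set.ncard {H : G.Subgraph | H.IsMatching ∧ H.edgeSet.ncard = k}

/-- The number of subgraphs of `G` isomorphic to the graph `X`. -/
noncomputable def numSubgraphs {V W : Type*} (G : SimpleGraph V) (X : SimpleGraph W) : ℕ :=
  Set.ncard {H : G.Subgraph | Nonempty (H.coe ≃g X)}

namespace SimpleGraph

open Finset

section Copies

variable {V W : Type*} {G : SimpleGraph V} {X : SimpleGraph W}

theorem Copy.adj_iff_of_finite [Finite W] (f : Copy X X) (a b : W) :
    X.Adj (f a) (f b) ↔ X.Adj a b := by
  refine ⟨fun h ↦ ?_, fun h ↦ f.toHom.map_adj h⟩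
  obtain ⟨⟨e, he⟩, hfe⟩ :=
    (Finite.injective_iff_surjective.1 f.mapEdgeSet.injective) ⟨s(f a, f b), h⟩
  induction e using Sym2.ind with
  | _ c d =>
    have : s(f c, f d) = s(f a, f b) := congrArg Subtype.val hfe
    have hinj : ∀ x y, f x = f y → x = y := fun x y hxy ↦ f.injective hxy
    rw [mem_edgeSet] at he
    rcases Sym2.eq_iff.1 this with ⟨h1, h2⟩ | ⟨h1, h2⟩
    · rwa [hinj _ _ h1, hinj _ _ h2] at he
    · rw [hinj _ _ h1, hinj _ _ h2] at he
      exact he.symm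

/-- On a finite graph, every copy of the graph in itself is an automorphism. -/
noncomputable def copySelfEquivIso [Finite W] : Copy X X ≃ (X ≃g X) where
  toFun f :=
    { Equiv.ofBijective f (Finite.injective_iff_bijective.1 f.injective) with
      map_rel_iff' := fun {a b} ↦ f.adj_iff_of_finite a b }
  invFun e := e.toCopy
  left_inv _ := rfl
  right_inv _ := RelIso.ext fun _ ↦ rfl

/-- A copy of `X` in `G` amounts to a subgraph of `G` with an isomorphism from `X` to it. -/
noncomputable def copyEquivSigma :
    Copy X G ≃ Σ H : {H : G.Subgraph // Nonempty (H.coe ≃g X)}, (X ≃g H.1.coe) :=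
  (Equiv.ofBijective
    (fun p : Σ H : {H : G.Subgraph // Nonempty (H.coe ≃g X)}, (X ≃g H.1.coe) ↦
      p.1.1.coeCopy.comp p.2.toCopy) (by
    constructor
    · rintro ⟨⟨H, hH⟩, e⟩ ⟨⟨K, hK⟩, f⟩ h
      have hv : ∀ w, (e w : V) = f w := fun w ↦ DFunLike.congr_fun h w
      have key : ∀ {H K : G.Subgraph} (e : X ≃g H.coe) (f : X ≃g K.coe),
          (∀ w, (e w : V) = f w) → H ≤ K := by
        intro H K e f hv
        refine ⟨fun v hv' ↦ ?_, fun u v huv ↦ ?_⟩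
        · obtain ⟨w, hw⟩ := e.surjective ⟨v, hv'⟩
          have := hv w
          rw [hw] at this
          rw [show v = f w from this]
          exact (f w).2
        · obtain ⟨a, ha⟩ := e.surjective ⟨u, H.edge_vert huv⟩
          obtain ⟨b, hb⟩ := e.surjective ⟨v, H.edge_vert huv.symm⟩
          have hab : X.Adj a b := by
            rw [← e.map_adj_iff, ha, hb]
            exact huv
          have h1 := f.map_adj_iff.2 hab
          have hua := hv a
          have hvb := hv b
          rw [ha] at hua
          rw [hb] at hvb
          rw [show u = f a from hua, show v = f b from hvb]
          exact h1
      obtain rfl : H = K := le_antisymm (key e f hv) (key f e fun w ↦ (hv w).symm)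
      congr 1
      ext w
      exact hv w
    · intro f
      exact ⟨⟨⟨f.toSubgraph, ⟨f.isoToSubgraph.symm⟩⟩, f.isoToSubgraph⟩, rfl⟩)).symm

theorem numSubgraphs_mul_card_copy_self [Finite W] :
    numSubgraphs G X * Nat.card (Copy X X) = Nat.card (Copy X G) := by
  have e : ∀ H : {H : G.Subgraph // Nonempty (H.coe ≃g X)}, (X ≃g H.1.coe) ≃ Copy X X := fun H ↦
    have f := H.2.some
    Equiv.trans ⟨fun g ↦ f.comp g, fun g ↦ f.symm.comp g, fun g ↦ by ext; simp,
      fun g ↦ by ext; simp⟩ copySelfEquivIso.symm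
  rw [Nat.card_congr (copyEquivSigma.trans ((Equiv.sigmaCongrRight e).trans
    (Equiv.sigmaEquivProd _ _))), Nat.card_prod]
  rfl

theorem card_copy_eq [Fintype V] [Fintype W] [DecidableEq V] [DecidableEq W] [DecidableRel G.Adj]
    [DecidableRel X.Adj] :
    Nat.card (Copy X G) =
      #{f : W → V | Function.Injective f ∧ ∀ i j, X.Adj i j → G.Adj (f i) (f j)} := by
  rw [← Fintype.card_subtype, ← Nat.card_eq_fintype_card]
  exact Nat.card_congr
    { toFun f := ⟨f, f.injective, fun i j h ↦ f.toHom.map_adj h⟩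
      invFun f := ⟨⟨f.1, fun {i j} h ↦ f.2.2 i j h⟩, f.2.1⟩
      left_inv _ := rfl
      right_inv _ := rfl }

instance (n : ℕ) : DecidableRel (pathGraph n).Adj := fun _ _ ↦ decidable_of_iff _ pathGraph_adj.symm

instance {V' : Type*} (A : SimpleGraph V) (B : SimpleGraph V') [DecidableRel A.Adj]
    [DecidableRel B.Adj] : DecidableRel (A ⊕g B).Adj
  | .inl _, .inl _ => decidable_of_iff _ sum_adj_inl.symm
  | .inr _, .inr _ => decidable_of_iff _ sum_adj_inr.symm
  | .inl _, .inr _ => isFalse (by simp)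
  | .inr _, .inl _ => isFalse (by simp)

/-- The tuple lists the vertices of a 4-cycle in cyclic order. -/
def IsFourCycle (G : SimpleGraph V) : V × V × V × V → Prop
  | (a, b, c, d) =>
    G.Adj a b ∧ G.Adj b c ∧ G.Adj c d ∧ G.Adj d a ∧ a ≠ c ∧ b ≠ d

instance [DecidableEq V] [DecidableRel G.Adj] : DecidablePred (IsFourCycle G) :=
  fun (a, b, c, d) ↦ by unfold IsFourCycle; infer_instance

/-- The tuple lists the vertices of a 6-cycle in cyclic order. -/
def IsSixCycle (G : SimpleGraph V) : V × V × V × V × V × V → Prop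
  | (a, b, c, d, e, f) =>
    G.Adj a b ∧ G.Adj b c ∧ G.Adj c d ∧ G.Adj d e ∧ G.Adj e f ∧ G.Adj f a ∧ a ≠ c ∧ a ≠ d ∧
    a ≠ e ∧ b ≠ d ∧ b ≠ e ∧ b ≠ f ∧ c ≠ e ∧ c ≠ f ∧ d ≠ f

instance [DecidableEq V] [DecidableRel G.Adj] : DecidablePred (IsSixCycle G) :=
  fun (a, b, c, d, e, f) ↦ by unfold IsSixCycle; infer_instance

/-- The tuple lists the vertices of a path with five edges in order. -/
def IsSixPath (G : SimpleGraph V) : V × V × V × V × V × V → Prop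
  | (a, b, c, d, e, f) =>
    G.Adj a b ∧ G.Adj b c ∧ G.Adj c d ∧ G.Adj d e ∧ G.Adj e f ∧ a ≠ c ∧ a ≠ d ∧ a ≠ e ∧ a ≠ f ∧
    b ≠ d ∧ b ≠ e ∧ b ≠ f ∧ c ≠ e ∧ c ≠ f ∧ d ≠ f

instance [DecidableEq V] [DecidableRel G.Adj] : DecidablePred (IsSixPath G) :=
  fun (a, b, c, d, e, f) ↦ by unfold IsSixPath; infer_instance

/-- The pair is a dart none of whose ends occurs in the 6-tuple. -/
def IsDartAvoiding (G : SimpleGraph V) : (V × V × V × V × V × V) → V × V → Prop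
  | (a, b, c, d, e, f), (u, w) =>
    G.Adj u w ∧ u ≠ a ∧ u ≠ b ∧ u ≠ c ∧ u ≠ d ∧ u ≠ e ∧ u ≠ f ∧ w ≠ a ∧ w ≠ b ∧ w ≠ c ∧ w ≠ d ∧
    w ≠ e ∧ w ≠ f

instance [DecidableEq V] [DecidableRel G.Adj] (x : V × V × V × V × V × V) :
    DecidablePred (IsDartAvoiding G x) :=
  fun (u, w) ↦ by unfold IsDartAvoiding; infer_instance

variable [Fintype V] [DecidableEq V] [DecidableRel G.Adj]

theorem card_copy_cycleGraph_four :
    Nat.card (Copy (cycleGraph 4) G) = #{x | IsFourCycle G x} := by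
  rw [card_copy_eq]
  refine Finset.card_nbij' (fun f ↦ (f 0, f 1, f 2, f 3))
    (fun x ↦ ![x.1, x.2.1, x.2.2.1, x.2.2.2]) ?_ ?_ ?_ ?_
  · simp only [coe_filter, mem_univ, true_and, Set.MapsTo, Set.mem_ofPred_eq]
    rintro f ⟨h1, h2⟩
    refine ⟨?_, ?_, ?_, ?_, ?_, ?_⟩
    iterate 4 exact h2 _ _ (by decide)
    all_goals exact h1.ne (by decide)
  · simp only [coe_filter, mem_univ, true_and, Set.MapsTo, Set.mem_ofPred_eq]
    rintro ⟨a, b, c, d⟩ h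
    unfold IsFourCycle at h
    constructor
    · intro i j hij
      fin_cases i <;> fin_cases j <;> first | rfl | (simp at hij; grind [SimpleGraph.irrefl])
    · intro i j hij
      fin_cases i <;> fin_cases j <;> first
        | exact absurd hij (by decide)
        | (simp; grind [adj_comm])
  · intro f _
    ext i
    fin_cases i <;> rfl
  · intro x _
    rfl

theorem card_copy_cycleGraph_six :
    Nat.card (Copy (cycleGraph 6) G) = #{x | IsSixCycle G x} := by
  rw [card_copy_eq]
  refine Finset.card_nbij' (fun f ↦ (f 0, f 1, f 2, f 3, f 4, f 5))
    (fun x ↦ ![x.1, x.2.1, x.2.2.1, x.2.2.2.1, x.2.2.2.2.1, x.2.2.2.2.2]) ?_ ?_ ?_ ?_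
  · simp only [coe_filter, mem_univ, true_and, Set.MapsTo, Set.mem_ofPred_eq]
    rintro f ⟨h1, h2⟩
    refine ⟨?_, ?_, ?_, ?_, ?_, ?_, ?_, ?_, ?_, ?_, ?_, ?_, ?_, ?_, ?_⟩
    iterate 6 exact h2 _ _ (by decide)
    all_goals exact h1.ne (by decide)
  · simp only [coe_filter, mem_univ, true_and, Set.MapsTo, Set.mem_ofPred_eq]
    rintro ⟨a, b, c, d, e, f⟩ h
    unfold IsSixCycle at h
    constructor
    · intro i j hij
      fin_cases i <;> fin_cases j <;> first | rfl | (simp at hij; grind [SimpleGraph.irrefl])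
    · intro i j hij
      fin_cases i <;> fin_cases j <;> first
        | exact absurd hij (by decide)
        | (simp; grind [adj_comm])
  · intro f _
    ext i
    fin_cases i <;> rfl
  · intro x _
    rfl

theorem card_copy_pathGraph_six_sum_pathGraph_two :
    Nat.card (Copy (pathGraph 6 ⊕g pathGraph 2) G) =
      #{x : (V × V × V × V × V × V) × V × V | IsSixPath G x.1 ∧ IsDartAvoiding G x.1 x.2} := by
  rw [card_copy_eq]
  refine Finset.card_nbij' (fun f ↦ ((f (.inl 0), f (.inl 1), f (.inl 2), f (.inl 3), f (.inl 4),
      f (.inl 5)), f (.inr 0), f (.inr 1)))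
    (fun x ↦ Sum.elim ![x.1.1, x.1.2.1, x.1.2.2.1, x.1.2.2.2.1, x.1.2.2.2.2.1, x.1.2.2.2.2.2]
      ![x.2.1, x.2.2]) ?_ ?_ ?_ ?_
  · simp only [coe_filter, mem_univ, true_and, Set.MapsTo, Set.mem_ofPred_eq]
    rintro f ⟨h1, h2⟩
    refine ⟨⟨?_, ?_, ?_, ?_, ?_, ?_, ?_, ?_, ?_, ?_, ?_, ?_, ?_, ?_, ?_⟩,
      ⟨?_, ?_, ?_, ?_, ?_, ?_, ?_, ?_, ?_, ?_, ?_, ?_, ?_⟩⟩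
    all_goals first | exact h1.ne (by decide) | exact h2 _ _ (by decide)
  · simp only [coe_filter, mem_univ, true_and, Set.MapsTo, Set.mem_ofPred_eq]
    rintro ⟨⟨a, b, c, d, e, f⟩, u, w⟩ ⟨h, h'⟩
    unfold IsSixPath at h
    unfold IsDartAvoiding at h'
    constructor
    · intro i j hij
      rcases i with i | i <;> rcases j with j | j <;> fin_cases i <;> fin_cases j <;>
        first | rfl | (simp at hij; grind [SimpleGraph.irrefl])
    · intro i j hij
      rcases i with i | i <;> rcases j with j | j <;> fin_cases i <;> fin_cases j <;> first
        | exact absurd hij (by decide)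
        | (simp; grind [adj_comm])
  · intro f _
    ext i
    rcases i with i | i <;> fin_cases i <;> rfl
  · intro x _
    rfl

end Copies

theorem card_copy_cycleGraph_four_self : Nat.card (Copy (cycleGraph 4) (cycleGraph 4)) = 8 := by
  rw [card_copy_cycleGraph_four]
  decide +kernel

theorem card_copy_cycleGraph_six_self : Nat.card (Copy (cycleGraph 6) (cycleGraph 6)) = 12 := by
  rw [card_copy_cycleGraph_six]
  decide +kernel

/-- The two orderings of the vertices of the long path in `P₅ + K₂`. -/
def sixPathOrderings : Finset ((Fin 6 ⊕ Fin 2) × (Fin 6 ⊕ Fin 2) × (Fin 6 ⊕ Fin 2) ×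
    (Fin 6 ⊕ Fin 2) × (Fin 6 ⊕ Fin 2) × (Fin 6 ⊕ Fin 2)) :=
  {(.inl 0, .inl 1, .inl 2, .inl 3, .inl 4, .inl 5),
    (.inl 5, .inl 4, .inl 3, .inl 2, .inl 1, .inl 0)}

/-- The two darts of the short path in `P₅ + K₂`. -/
def shortPathDarts : Finset ((Fin 6 ⊕ Fin 2) × (Fin 6 ⊕ Fin 2)) :=
  {(.inr 0, .inr 1), (.inr 1, .inr 0)}

theorem isSixPath_iff_mem_sixPathOrderings (x) :
    IsSixPath (pathGraph 6 ⊕g pathGraph 2) x ↔ x ∈ sixPathOrderings := by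
  constructor
  · obtain ⟨a, b, c, d, e, f⟩ := x
    rintro ⟨h1, h2, h3, h4, h5, h6, -, -, -, h7, -, -, h8, -, h9⟩
    rcases a with a | a <;> rcases b with b | b <;> try (simp at h1; done)
    all_goals rcases c with c | c <;> try (simp at h2; done)
    · rcases d with d | d <;> try (simp at h3; done)
      rcases e with e | e <;> try (simp at h4; done)
      rcases f with f | f <;> try (simp at h5; done)
      simp only [sum_adj_inl, pathGraph_adj] at h1 h2 h3 h4 h5
      simp only [ne_eq, Sum.inl.injEq] at h6 h7 h8 h9
      simp only [sixPathOrderings, mem_insert, mem_singleton, Prod.mk.injEq, Sum.inl.injEq]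
      omega
    · simp only [sum_adj_inr, pathGraph_adj] at h1 h2
      simp only [ne_eq, Sum.inr.injEq] at h6
      omega
  · intro h
    fin_cases h <;> simp [IsSixPath, pathGraph_adj]

theorem isDartAvoiding_iff_mem_shortPathDarts {x} (hx : x ∈ sixPathOrderings) (y) :
    IsDartAvoiding (pathGraph 6 ⊕g pathGraph 2) x y ↔ y ∈ shortPathDarts := by
  obtain ⟨u, w⟩ := y
  fin_cases hx <;> revert u w <;> decide +kernel

theorem card_copy_pathGraph_six_sum_pathGraph_two_self :
    Nat.card (Copy (pathGraph 6 ⊕g pathGraph 2) (pathGraph 6 ⊕g pathGraph 2)) = 4 := by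
  refine card_copy_pathGraph_six_sum_pathGraph_two.trans ?_
  refine Eq.trans (congrArg card ?_) (show #(sixPathOrderings ×ˢ shortPathDarts) = 4 from rfl)
  ext ⟨x, y⟩
  rw [mem_filter_univ, mem_product, isSixPath_iff_mem_sixPathOrderings]
  exact and_congr_right fun hx ↦ isDartAvoiding_iff_mem_shortPathDarts hx y

section Counting

theorem card_filter_prod {α β : Type*} [Fintype α] [Fintype β] (R : α × β → Prop) (P : β → Prop)
    [DecidablePred R] [DecidablePred P] (k : ℕ) (hP : ∀ a b, R (a, b) → P b)
    (hk : ∀ b, P b → #{a | R (a, b)} = k) : #{x | R x} = k * #{b | P b} := by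
  rw [card_filter, Fintype.sum_prod_type_right, card_filter, mul_sum]
  refine sum_congr rfl fun b _ ↦ ?_
  rw [← card_filter]
  split_ifs with h
  · rw [hk b h, mul_one]
  · rw [mul_zero, card_eq_zero, filter_eq_empty_iff]
    exact fun a _ ha ↦ h (hP a b ha)

variable {V : Type*} [Fintype V] [DecidableEq V] {G : SimpleGraph V} [DecidableRel G.Adj]

omit [DecidableEq V] in
theorem IsRegularOfDegree.card_adj {k : ℕ} (hreg : G.IsRegularOfDegree k) (v : V) :
    #{a | G.Adj a v} = k := by
  rw [← hreg v, ← card_neighborFinset_eq_degree]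
  congr 1
  ext
  simp [adj_comm]

theorem IsRegularOfDegree.card_adj_ne (hreg : G.IsRegularOfDegree 3) {u v : V} (h : G.Adj u v) :
    #{a | G.Adj a v ∧ a ≠ u} = 2 := by
  rw [filter_and_not, filter_eq' _ u, if_pos (mem_univ u), card_sdiff_of_subset (by simpa using h),
    hreg.card_adj, card_singleton]

theorem IsRegularOfDegree.card_adj_ne_ne (hreg : G.IsRegularOfDegree 3) {u v w : V}
    (h : G.Adj u v) (h' : G.Adj w v) (hne : u ≠ w) : #{a | G.Adj a v ∧ a ≠ u ∧ a ≠ w} = 1 := by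
  have : ({a | G.Adj a v ∧ a ≠ u ∧ a ≠ w} : Finset V) =
      ({a | G.Adj a v} : Finset V) \ {u, w} := by
    ext; simp
  rw [this, card_sdiff_of_subset (by grind), hreg.card_adj, card_pair hne]

/-- The tuple lists the vertices of a walk with five edges that never turns back along the edge
it has just used. -/
def IsNonbacktrackingSixWalk (G : SimpleGraph V) : V × V × V × V × V × V → Prop
  | (a, b, c, d, e, f) =>
    G.Adj a b ∧ G.Adj b c ∧ G.Adj c d ∧ G.Adj d e ∧ G.Adj e f ∧ a ≠ c ∧ b ≠ d ∧ c ≠ e ∧ d ≠ f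

instance : DecidablePred (IsNonbacktrackingSixWalk G) :=
  fun (a, b, c, d, e, f) ↦ by unfold IsNonbacktrackingSixWalk; infer_instance

omit [DecidableEq V] in
theorem IsRegularOfDegree.card_darts (hreg : G.IsRegularOfDegree 3) :
    #{x : V × V | G.Adj x.1 x.2} = 3 * Fintype.card V := by
  rw [card_filter_prod _ (fun _ ↦ True) 3 (by simp) fun v _ ↦ hreg.card_adj v]
  simp

theorem IsRegularOfDegree.card_isNonbacktrackingSixWalk (hreg : G.IsRegularOfDegree 3) :
    #{x | IsNonbacktrackingSixWalk G x} = 48 * Fintype.card V := by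
  rw [card_filter_prod _ (fun (b, c, d, e, f) ↦
      G.Adj b c ∧ G.Adj c d ∧ G.Adj d e ∧ G.Adj e f ∧ b ≠ d ∧ c ≠ e ∧ d ≠ f) 2
      (by simp only [IsNonbacktrackingSixWalk]; grind) ?_,
    card_filter_prod _ (fun (c, d, e, f) ↦ G.Adj c d ∧ G.Adj d e ∧ G.Adj e f ∧ c ≠ e ∧ d ≠ f) 2
      (by grind) ?_,
    card_filter_prod _ (fun (d, e, f) ↦ G.Adj d e ∧ G.Adj e f ∧ d ≠ f) 2 (by grind) ?_,
    card_filter_prod _ (fun (e, f) ↦ G.Adj e f) 2 (by grind) ?_, hreg.card_darts]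
  · ring
  · rintro ⟨e, f⟩ h
    rw [← hreg.card_adj_ne h.symm]
    congr 1
    grind
  · rintro ⟨d, e, f⟩ h
    rw [← hreg.card_adj_ne h.1.symm]
    congr 1
    grind
  · rintro ⟨c, d, e, f⟩ h
    rw [← hreg.card_adj_ne h.1.symm]
    congr 1
    grind
  · rintro ⟨b, c, d, e, f⟩ h
    rw [← hreg.card_adj_ne h.1.symm]
    congr 1
    grind [IsNonbacktrackingSixWalk]

/-- Reversal of a 6-tuple. -/
def reverseSix : V × V × V × V × V × V → V × V × V × V × V × V
  | (a, b, c, d, e, f) => (f, e, d, c, b, a)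

omit [DecidableEq V] in
theorem card_filter_reverseSix (P : V × V × V × V × V × V → Prop) [DecidablePred P] :
    #{x | P (reverseSix x)} = #{x | P x} :=
  card_nbij' reverseSix reverseSix (by intro x; simp)
    (fun x hx ↦ by simp only [coe_filter, mem_univ, true_and, Set.mem_ofPred_eq] at hx ⊢; exact hx)
    (fun _ _ ↦ rfl) (fun _ _ ↦ rfl)

omit [Fintype V] [DecidableEq V] [DecidableRel G.Adj] in
theorem Coloring.eq_not_of_adj (col : G.Coloring Bool) (u v : V) (h : G.Adj u v) :
    col v = !col u :=
  Bool.eq_not.2 (col.valid h).symm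

omit [Fintype V] [DecidableEq V] [DecidableRel G.Adj] in
theorem isSixPath_iff (col : G.Coloring Bool) (a b c d e f : V) :
    IsSixPath G (a, b, c, d, e, f) ↔
      IsNonbacktrackingSixWalk G (a, b, c, d, e, f) ∧ a ≠ e ∧ b ≠ f := by
  have hcol := col.eq_not_of_adj
  simp only [IsSixPath, IsNonbacktrackingSixWalk]
  grind

theorem IsRegularOfDegree.card_isNonbacktrackingSixWalk_right (hreg : G.IsRegularOfDegree 3) :
    #{x | IsNonbacktrackingSixWalk G x ∧ x.2.1 = x.2.2.2.2.2} = 2 * #{x | IsFourCycle G x} := by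
  rw [← card_filter_prod (fun x : V × V × V × V × V ↦ match x with
    | (a, b, c, d, e) => IsFourCycle G (b, c, d, e) ∧ G.Adj a b ∧ a ≠ c) _ 2 (by grind)]
  · refine card_nbij' (fun (a, b, c, d, e, f) ↦ (a, b, c, d, e))
      (fun (a, b, c, d, e) ↦ (a, b, c, d, e, b)) ?_ ?_ ?_ ?_
    · rintro ⟨a, b, c, d, e, f⟩ h
      simp [IsNonbacktrackingSixWalk, IsFourCycle] at h ⊢
      grind
    · rintro ⟨a, b, c, d, e⟩ h
      simp [IsNonbacktrackingSixWalk, IsFourCycle] at h ⊢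
      grind
    · rintro ⟨a, b, c, d, e, f⟩ h
      simp at h ⊢
      grind
    · rintro ⟨a, b, c, d, e⟩ h
      rfl
  · rintro ⟨b, c, d, e⟩ h
    rw [← hreg.card_adj_ne h.1.symm]
    congr 1
    grind

theorem IsRegularOfDegree.card_isNonbacktrackingSixWalk_left (hreg : G.IsRegularOfDegree 3) :
    #{x | IsNonbacktrackingSixWalk G x ∧ x.1 = x.2.2.2.2.1} = 2 * #{x | IsFourCycle G x} := by
  rw [← hreg.card_isNonbacktrackingSixWalk_right, ← card_filter_reverseSix]
  congr 1
  ext ⟨a, b, c, d, e, f⟩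
  simp only [IsNonbacktrackingSixWalk, reverseSix]
  grind [adj_comm]

theorem card_isNonbacktrackingSixWalk_both :
    #{x | IsNonbacktrackingSixWalk G x ∧ x.1 = x.2.2.2.2.1 ∧ x.2.1 = x.2.2.2.2.2} =
      #{x | IsFourCycle G x} := by
  refine card_nbij' (fun (a, b, c, d, e, f) ↦ (a, b, c, d))
      (fun (a, b, c, d) ↦ (a, b, c, d, a, b)) ?_ ?_ ?_ ?_
  · rintro ⟨a, b, c, d, e, f⟩ h
    simp [IsNonbacktrackingSixWalk, IsFourCycle] at h ⊢
    grind
  · rintro ⟨a, b, c, d⟩ h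
    simp [IsNonbacktrackingSixWalk, IsFourCycle] at h ⊢
    grind
  · rintro ⟨a, b, c, d, e, f⟩ h
    simp at h ⊢
    grind
  · rintro ⟨a, b, c, d⟩ h
    rfl

theorem IsRegularOfDegree.card_isSixPath (hreg : G.IsRegularOfDegree 3) (col : G.Coloring Bool) :
    #{x | IsSixPath G x} + 3 * #{x | IsFourCycle G x} = 48 * Fintype.card V := by
  have key : #{x | IsSixPath G x} + #{x | IsNonbacktrackingSixWalk G x ∧ x.1 = x.2.2.2.2.1} +
      #{x | IsNonbacktrackingSixWalk G x ∧ x.2.1 = x.2.2.2.2.2} =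
      #{x | IsNonbacktrackingSixWalk G x} +
        #{x | IsNonbacktrackingSixWalk G x ∧ x.1 = x.2.2.2.2.1 ∧ x.2.1 = x.2.2.2.2.2} := by
    simp only [card_filter, ← sum_add_distrib]
    refine sum_congr rfl fun ⟨a, b, c, d, e, f⟩ _ ↦ ?_
    simp only [isSixPath_iff col]
    by_cases h1 : IsNonbacktrackingSixWalk G (a, b, c, d, e, f) <;> by_cases h2 : a = e <;>
      by_cases h3 : b = f <;> simp [h1, h2, h3]
  rw [hreg.card_isNonbacktrackingSixWalk_left, hreg.card_isNonbacktrackingSixWalk_right,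
    card_isNonbacktrackingSixWalk_both, hreg.card_isNonbacktrackingSixWalk] at key
  omega

theorem IsRegularOfDegree.card_isSixPath_middle_chord (hreg : G.IsRegularOfDegree 3)
    (col : G.Coloring Bool) :
    #{x | IsSixPath G x ∧ G.Adj x.2.1 x.2.2.2.2.1} = #{x | IsFourCycle G x} := by
  have hcol := col.eq_not_of_adj
  trans #{x : V × V × V × V × V × V | match x with
    | (a, f, b, c, d, e) => IsFourCycle G (b, c, d, e) ∧ (G.Adj f e ∧ f ≠ b ∧ f ≠ d) ∧
        (G.Adj a b ∧ a ≠ c ∧ a ≠ e)}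
  · refine card_nbij' (fun (a, b, c, d, e, f) ↦ (a, f, b, c, d, e))
      (fun (a, f, b, c, d, e) ↦ (a, b, c, d, e, f)) ?_ ?_ (fun _ _ ↦ rfl) (fun _ _ ↦ rfl)
    · rintro ⟨a, b, c, d, e, f⟩ h
      simp only [isSixPath_iff col, coe_filter, mem_univ, true_and, Set.mem_ofPred_eq] at h ⊢
      simp only [IsNonbacktrackingSixWalk, IsFourCycle] at h ⊢
      grind [adj_comm]
    · rintro ⟨a, f, b, c, d, e⟩ h
      simp only [isSixPath_iff col, coe_filter, mem_univ, true_and, Set.mem_ofPred_eq] at h ⊢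
      simp only [IsNonbacktrackingSixWalk, IsFourCycle] at h ⊢
      grind [adj_comm]
  · rw [card_filter_prod _ (fun (f, b, c, d, e) ↦
        IsFourCycle G (b, c, d, e) ∧ (G.Adj f e ∧ f ≠ b ∧ f ≠ d)) 1 (by grind),
      card_filter_prod _ (fun (b, c, d, e) ↦ IsFourCycle G (b, c, d, e)) 1 (by grind)]
    · simp
    · rintro ⟨b, c, d, e⟩ h
      simp only [IsFourCycle] at h
      rw [← hreg.card_adj_ne_ne h.2.2.2.1.symm h.2.2.1 h.2.2.2.2.1]
      congr 1
      simp only [IsFourCycle]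
      grind
    · rintro ⟨f, b, c, d, e⟩ h
      simp only [IsFourCycle] at h
      rw [← hreg.card_adj_ne_ne h.1.1.symm h.1.2.2.2.1 h.1.2.2.2.2.2]
      congr 1
      simp only [IsFourCycle]
      grind

theorem IsRegularOfDegree.card_isSixPath_right_chord (hreg : G.IsRegularOfDegree 3)
    (col : G.Coloring Bool) (h23 : ∀ u v a b c, G.Adj a u → G.Adj b u → G.Adj c u → G.Adj a v →
      G.Adj b v → G.Adj c v → u ≠ v → a ≠ b → a ≠ c → b ≠ c → False) :
    #{x | IsSixPath G x ∧ G.Adj x.2.2.1 x.2.2.2.2.2} = 2 * #{x | IsFourCycle G x} := by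
  rw [card_filter_prod _ (fun (b, c, d, e, f) ↦
        IsFourCycle G (c, d, e, f) ∧ (G.Adj b c ∧ b ≠ d ∧ b ≠ f)) 2,
      card_filter_prod _ (fun (c, d, e, f) ↦ IsFourCycle G (c, d, e, f)) 1 (by grind)]
  · simp
  · rintro ⟨c, d, e, f⟩ h
    simp only [IsFourCycle] at h
    rw [← hreg.card_adj_ne_ne h.1.symm h.2.2.2.1 h.2.2.2.2.2]
    congr 1
    simp only [IsFourCycle]
    grind
  · rintro a ⟨b, c, d, e, f⟩ h
    simp only [isSixPath_iff col] at h
    simp only [IsNonbacktrackingSixWalk, IsFourCycle] at h ⊢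
    grind [adj_comm]
  · rintro ⟨b, c, d, e, f⟩ h
    simp only [IsFourCycle] at h
    rw [← hreg.card_adj_ne h.2.1.symm]
    congr 1
    ext a
    simp only [mem_filter_univ, isSixPath_iff col, IsNonbacktrackingSixWalk]
    have := h23 c e b d f
    grind [adj_comm]

theorem IsRegularOfDegree.card_isSixPath_left_chord (hreg : G.IsRegularOfDegree 3)
    (col : G.Coloring Bool) (h23 : ∀ u v a b c, G.Adj a u → G.Adj b u → G.Adj c u → G.Adj a v →
      G.Adj b v → G.Adj c v → u ≠ v → a ≠ b → a ≠ c → b ≠ c → False) :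
    #{x | IsSixPath G x ∧ G.Adj x.1 x.2.2.2.1} = 2 * #{x | IsFourCycle G x} := by
  rw [← hreg.card_isSixPath_right_chord col h23, ← card_filter_reverseSix]
  congr 1
  ext ⟨a, b, c, d, e, f⟩
  simp only [IsSixPath, reverseSix]
  grind [adj_comm]

theorem card_isSixPath_end_chord :
    #{x | IsSixPath G x ∧ G.Adj x.1 x.2.2.2.2.2} = #{x | IsSixCycle G x} := by
  congr 1
  ext ⟨a, b, c, d, e, f⟩
  simp only [IsSixPath, IsSixCycle]
  grind [adj_comm, SimpleGraph.irrefl]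

theorem IsRegularOfDegree.card_darts_avoiding (hreg : G.IsRegularOfDegree 3) (S : Finset V) :
    #{x : V × V | G.Adj x.1 x.2 ∧ x.1 ∉ S ∧ x.2 ∉ S} + 6 * #S =
      3 * Fintype.card V + ∑ u ∈ S, ∑ w ∈ S, if G.Adj u w then 1 else 0 := by
  have h2 : #{x : V × V | G.Adj x.1 x.2 ∧ x.2 ∈ S} = 3 * #S := by
    rw [card_filter_prod _ (· ∈ S) 3 (by grind), filter_univ_mem]
    intro w hw
    simp only [hw, and_true]
    exact hreg.card_adj w
  have h1 : #{x : V × V | G.Adj x.1 x.2 ∧ x.1 ∈ S} = 3 * #S := by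
    rw [← h2]
    exact card_nbij' Prod.swap Prod.swap (by intro x; simp [adj_comm]) (by intro x; simp [adj_comm])
      (fun _ _ ↦ rfl) (fun _ _ ↦ rfl)
  have h12 : #{x : V × V | G.Adj x.1 x.2 ∧ x.1 ∈ S ∧ x.2 ∈ S} =
      ∑ u ∈ S, ∑ w ∈ S, if G.Adj u w then 1 else 0 := by
    rw [← sum_product', ← card_filter]
    congr 1
    grind
  rw [← h12, ← hreg.card_darts]
  have key : #{x : V × V | G.Adj x.1 x.2 ∧ x.1 ∉ S ∧ x.2 ∉ S} +
      #{x : V × V | G.Adj x.1 x.2 ∧ x.1 ∈ S} + #{x : V × V | G.Adj x.1 x.2 ∧ x.2 ∈ S} =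
      #{x : V × V | G.Adj x.1 x.2} + #{x : V × V | G.Adj x.1 x.2 ∧ x.1 ∈ S ∧ x.2 ∈ S} := by
    simp only [card_filter, ← sum_add_distrib]
    refine sum_congr rfl fun x _ ↦ ?_
    by_cases h1 : G.Adj x.1 x.2 <;> by_cases h2 : x.1 ∈ S <;> by_cases h3 : x.2 ∈ S <;>
      simp [h1, h2, h3]
  omega

/-- The number of chords of a path with five edges, except those joining vertices in the same
class of a bipartition. -/
def numChords (G : SimpleGraph V) [DecidableRel G.Adj] (x : V × V × V × V × V × V) : ℕ :=
  (if G.Adj x.1 x.2.2.2.1 then 1 else 0) + (if G.Adj x.2.1 x.2.2.2.2.1 then 1 else 0) +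
    (if G.Adj x.2.2.1 x.2.2.2.2.2 then 1 else 0) + if G.Adj x.1 x.2.2.2.2.2 then 1 else 0

theorem IsRegularOfDegree.card_isDartAvoiding (hreg : G.IsRegularOfDegree 3)
    (col : G.Coloring Bool) (x : V × V × V × V × V × V) (hx : IsSixPath G x) :
    #{y | IsDartAvoiding G x y} + 26 = 3 * Fintype.card V + 2 * numChords G x := by
  obtain ⟨a, b, c, d, e, f⟩ := x
  have h := hreg.card_darts_avoiding {a, b, c, d, e, f}
  have hS : #({a, b, c, d, e, f} : Finset V) = 6 := by
    simp only [IsSixPath] at hx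
    grind [SimpleGraph.irrefl]
  have hcount : ∑ u ∈ ({a, b, c, d, e, f} : Finset V), ∑ w ∈ ({a, b, c, d, e, f} : Finset V),
      (if G.Adj u w then 1 else 0) = 10 + 2 * numChords G (a, b, c, d, e, f) := by
    have hcol := col.eq_not_of_adj
    simp only [IsSixPath] at hx
    obtain ⟨hab, hbc, hcd, hde, hef, hne⟩ := hx
    have hne' : a ≠ b ∧ b ≠ c ∧ c ≠ d ∧ d ≠ e ∧ e ≠ f :=
      ⟨hab.ne, hbc.ne, hcd.ne, hde.ne, hef.ne⟩
    have hac : ¬ G.Adj a c := by grind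
    have hae : ¬ G.Adj a e := by grind
    have hce : ¬ G.Adj c e := by grind
    have hbd : ¬ G.Adj b d := by grind
    have hbf : ¬ G.Adj b f := by grind
    have hdf : ¬ G.Adj d f := by grind
    have hexp : ∀ g : V → ℕ, ∑ w ∈ ({a, b, c, d, e, f} : Finset V), g w =
        g a + g b + g c + g d + g e + g f := fun g ↦ by
      rw [sum_insert (by grind), sum_insert (by grind), sum_insert (by grind),
        sum_insert (by grind), sum_insert (by grind), sum_singleton]
      ring
    simp only [hexp, numChords]
    simp only [G.adj_comm b a, G.adj_comm c b, G.adj_comm d c, G.adj_comm e d, G.adj_comm f e,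
      G.adj_comm c a, G.adj_comm e a, G.adj_comm e c, G.adj_comm d b, G.adj_comm f b,
      G.adj_comm f d, G.adj_comm d a, G.adj_comm e b, G.adj_comm f c, G.adj_comm f a,
      hab, hbc, hcd, hde, hef, hac, hae, hce, hbd, hbf, hdf, SimpleGraph.irrefl, if_true, if_false]
    ring
  have hset : #{y | IsDartAvoiding G (a, b, c, d, e, f) y} = #{x : V × V | G.Adj x.1 x.2 ∧
      x.1 ∉ ({a, b, c, d, e, f} : Finset V) ∧ x.2 ∉ ({a, b, c, d, e, f} : Finset V)} := by
    congr 1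
    ext ⟨u, w⟩
    simp only [IsDartAvoiding, mem_insert, mem_singleton, not_or, and_assoc, ne_eq]
  rw [hS, hcount, ← hset] at h
  omega

theorem IsRegularOfDegree.sum_numChords_isSixPath (hreg : G.IsRegularOfDegree 3)
    (col : G.Coloring Bool) (h23 : ∀ u v a b c, G.Adj a u → G.Adj b u → G.Adj c u → G.Adj a v →
      G.Adj b v → G.Adj c v → u ≠ v → a ≠ b → a ≠ c → b ≠ c → False) :
    ∑ x with IsSixPath G x, numChords G x = 5 * #{x | IsFourCycle G x} + #{x | IsSixCycle G x} := by
  simp only [numChords, sum_add_distrib, ← card_filter, filter_filter]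
  rw [hreg.card_isSixPath_left_chord col h23, hreg.card_isSixPath_right_chord col h23,
    hreg.card_isSixPath_middle_chord col, card_isSixPath_end_chord]
  ring

end Counting

theorem not_completeBipartite_two_three {V : Type*} {G : SimpleGraph V}
    (hshare : ∀ H₁ H₂ : G.Subgraph, Nonempty (H₁.coe ≃g cycleGraph 4) →
      Nonempty (H₂.coe ≃g cycleGraph 4) → H₁ ≠ H₂ → (H₁.edgeSet ∩ H₂.edgeSet).ncard ≤ 1)
    (u v a b c : V) (hau : G.Adj a u) (hbu : G.Adj b u) (hcu : G.Adj c u) (hav : G.Adj a v)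
    (hbv : G.Adj b v) (hcv : G.Adj c v) (huv : u ≠ v) (hab : a ≠ b) (hac : a ≠ c) (hbc : b ≠ c) :
    False := by
  have copy : ∀ x, G.Adj x u → G.Adj x v → x ≠ a → ∃ f : Copy (cycleGraph 4) G,
      (f : Fin 4 → V) = ![u, a, v, x] := by
    intro x hxu hxv hxa
    refine ⟨⟨⟨![u, a, v, x], ?_⟩, ?_⟩, rfl⟩
    · intro i j hij
      fin_cases i <;> fin_cases j <;> first
        | exact absurd hij (by decide)
        | (simp; grind [adj_comm])
    · intro i j hij
      fin_cases i <;> fin_cases j <;> first | rfl | (simp at hij; grind [SimpleGraph.irrefl])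
  obtain ⟨f, hf⟩ := copy b hbu hbv hab.symm
  obtain ⟨g, hg⟩ := copy c hcu hcv hac.symm
  have hmem : ∀ f : Copy (cycleGraph 4) G, f 0 = u → f 1 = a → f 2 = v →
      s(u, a) ∈ f.toSubgraph.edgeSet ∧ s(a, v) ∈ f.toSubgraph.edgeSet := by
    rintro f rfl rfl rfl
    exact ⟨⟨0, 1, (show (cycleGraph 4).Adj 0 1 by decide), rfl, rfl⟩,
      ⟨1, 2, (show (cycleGraph 4).Adj 1 2 by decide), rfl, rfl⟩⟩
  obtain ⟨hf1, hf2⟩ := hmem f (by simp [hf]) (by simp [hf]) (by simp [hf])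
  obtain ⟨hg1, hg2⟩ := hmem g (by simp [hg]) (by simp [hg]) (by simp [hg])
  have hne : f.toSubgraph ≠ g.toSubgraph := by
    intro h
    have hc : c ∈ g.toSubgraph.verts := ⟨3, trivial, congrFun hg 3⟩
    rw [← h] at hc
    obtain ⟨i, -, hi⟩ := hc
    have hi' : f i = c := hi
    rw [hf] at hi'
    fin_cases i <;> simp at hi' <;> grind [SimpleGraph.irrefl]
  have hle := hshare _ _ ⟨f.isoToSubgraph.symm⟩ ⟨g.isoToSubgraph.symm⟩ hne
  have hfin : (f.toSubgraph.edgeSet ∩ g.toSubgraph.edgeSet).Finite := by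
    refine Set.Finite.inter_of_left ?_ _
    rw [Subgraph.edgeSet_map]
    exact Set.Finite.image _ (Set.toFinite _)
  have := (Set.ncard_le_one hfin).1 hle _ ⟨hf1, hg1⟩ _ ⟨hf2, hg2⟩
  grind [SimpleGraph.irrefl]

end SimpleGraph

open Finset in
theorem stmt_16 {V : Type*} [Fintype V] [DecidableEq V] (G : SimpleGraph V) [DecidableRel G.Adj]
    (hreg : G.IsRegularOfDegree 3) (hbip : G.Colorable 2) (t : ℕ) (ht : 1 ≤ t)
    (hcard : Fintype.card V = 6 * t + 8)
    (hsix : numSubgraphs G (cycleGraph 4) = 6)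
    (hshare : ∀ H₁ H₂ : G.Subgraph, Nonempty (H₁.coe ≃g cycleGraph 4) →
      Nonempty (H₂.coe ≃g cycleGraph 4) → H₁ ≠ H₂ →
      (H₁.edgeSet ∩ H₂.edgeSet).ncard ≤ 1)
    (hsixcycles : numSubgraphs G (cycleGraph 6) = 4 * t + 7) :
    numSubgraphs G (pathGraph 6 ⊕g pathGraph 2) = 144 * (3 * t) ^ 2 + 320 * (3 * t) + 42 := by
  have col : G.Coloring Bool := hbip.toColoring (by simp)
  have h4 := numSubgraphs_mul_card_copy_self (G := G) (X := cycleGraph 4)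
  have h6 := numSubgraphs_mul_card_copy_self (G := G) (X := cycleGraph 6)
  have hP := numSubgraphs_mul_card_copy_self (G := G) (X := pathGraph 6 ⊕g pathGraph 2)
  rw [hsix, card_copy_cycleGraph_four_self, card_copy_cycleGraph_four] at h4
  rw [hsixcycles, card_copy_cycleGraph_six_self, card_copy_cycleGraph_six] at h6
  rw [card_copy_pathGraph_six_sum_pathGraph_two_self,
    card_copy_pathGraph_six_sum_pathGraph_two] at hP
  have hchords := hreg.sum_numChords_isSixPath col (not_completeBipartite_two_three hshare)
  have hpaths := hreg.card_isSixPath col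
  have hsum : #{x : (V × V × V × V × V × V) × V × V | IsSixPath G x.1 ∧ IsDartAvoiding G x.1 x.2} =
      ∑ x with IsSixPath G x, #{y | IsDartAvoiding G x y} := by
    rw [card_filter, Fintype.sum_prod_type, sum_filter]
    refine sum_congr rfl fun x _ ↦ ?_
    split_ifs with hx <;> simp [hx]
  have hdarts : ∑ x with IsSixPath G x, #{y | IsDartAvoiding G x y} +
      #{x | IsSixPath G x} * 26 = #{x | IsSixPath G x} * (3 * Fintype.card V) +
        2 * ∑ x with IsSixPath G x, numChords G x := by
    rw [mul_sum, ← smul_eq_mul, ← smul_eq_mul, ← sum_const, ← sum_const, ← sum_add_distrib,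
      ← sum_add_distrib]
    exact sum_congr rfl fun x hx ↦ hreg.card_isDartAvoiding col x (by simpa using hx)
  rw [hchords, ← h4, ← h6, ← hsum, ← hP, hcard] at hdarts
  rw [← h4, hcard] at hpaths
  have hpaths' : #{x | IsSixPath G x} = 288 * t + 240 := by omega
  rw [hpaths'] at hdarts
  nlinarith
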